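/- arXiv:1611.07891 — 5 statements merged into one kernel-verified Lean document; each statement's English description precedes it below -/
import Mathlib

section
/- Let P₁: ℝ^d → ℝ^{s₁} and P₂: ℝ^d → ℝ^{s₂} be Lipschitz continuous near z̄, let D₁ ⊂ ℝ^{s₁} be closed, and let Q: ℝ^d ⇉ ℝ^{s₂} be a set-valued map with closed graph. Suppose P₁(z̄) ∈ D₁ and 0 ∈ P₂(z̄) + Q(z̄). Then the set-valued map M₁(z) := (P₁(z) − D₁) × (P₂(z) + Q(z)) is metrically subregular at (z̄, (0,0)) if and only if the set-valued map M₂(z) := (P₁(z), (z, −P₂(z))) − D₁ × gph Q is metrically subregular at (z̄, (0,0,0)). -/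
open Filter Topology Set

noncomputable section

/-- `ℝ^d` as a Euclidean space. -/
abbrev Eu (d : ℕ) := EuclideanSpace ℝ (Fin d)

/-- A set-valued map `M` is metrically subregular at `(zb, wb) ∈ gph M`:
there are a neighborhood `W` of `zb` and `κ > 0` with
`dist(z, M⁻¹(wb)) ≤ κ ⬝ dist(wb, M z)` for all `z ∈ W`
(extended-real distances; `dist` to the empty set is `∞`). -/
def msr {E F : Type*} [NormedAddCommGroup E] [NormedAddCommGroup F]
    (M : E → Set F) (zb : E) (wb : F) : Prop :=
  ∃ κ : ℝ, 0 < κ ∧ ∃ W ∈ 𝓝 zb, ∀ z ∈ W,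
    EMetric.infEdist z {z' | wb ∈ M z'} ≤ ENNReal.ofReal κ * EMetric.infEdist wb (M z)

/-- Metric subregularity expressed through real-valued distances and individual values of `M`. -/
theorem msr_iff_infDist {E F : Type*} [NormedAddCommGroup E] [NormedAddCommGroup F]
    {M : E → Set F} {zb : E} {wb : F} (h : wb ∈ M zb) :
    msr M zb wb ↔ ∃ κ : ℝ, 0 < κ ∧ ∃ r > 0, ∀ z ∈ Metric.ball zb r, ∀ w ∈ M z,
      Metric.infDist z {z' | wb ∈ M z'} ≤ κ * dist wb w := by
  have hne : {z' | wb ∈ M z'}.Nonempty := ⟨zb, h⟩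
  have key : ∀ κ : ℝ, 0 < κ → ∀ z,
      (Metric.infEDist z {z' | wb ∈ M z'} ≤ ENNReal.ofReal κ * Metric.infEDist wb (M z) ↔
        ∀ w ∈ M z, Metric.infDist z {z' | wb ∈ M z'} ≤ κ * dist wb w) := by
    intro κ hκ z
    have hκ0 : ENNReal.ofReal κ ≠ 0 := by simpa using hκ
    rw [← ENNReal.div_le_iff' hκ0 ENNReal.ofReal_ne_top,
      Metric.le_infEDist]
    refine forall₂_congr fun w _ => ?_
    rw [ENNReal.div_le_iff' hκ0 ENNReal.ofReal_ne_top, edist_dist,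
      ← ENNReal.ofReal_mul hκ.le, Metric.infDist,
      ENNReal.le_ofReal_iff_toReal_le (Metric.infEDist_ne_top hne) (by positivity)]
  constructor
  · rintro ⟨κ, hκ, W, hW, H⟩
    obtain ⟨r, hr, hrW⟩ := Metric.mem_nhds_iff.1 hW
    exact ⟨κ, hκ, r, hr, fun z hz => (key κ hκ z).1 (H z (hrW hz))⟩
  · rintro ⟨κ, hκ, r, hr, H⟩
    exact ⟨κ, hκ, _, Metric.ball_mem_nhds zb hr, fun z hz => (key κ hκ z).2 (H z hz)⟩

/-- the two ways of writing the constraint system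
`P₁(z) ∈ D₁, 0 ∈ P₂(z) + Q(z)` as a set-valued map — namely
`M₁(z) = (P₁(z) − D₁) × (P₂(z) + Q(z))` and
`M₂(z) = (P₁(z), (z, −P₂(z))) − D₁ × gph Q` — have equivalent metric subregularity
properties at the reference point. -/
theorem stmt_4 {d s₁ s₂ : ℕ}
    (P₁ : Eu d → Eu s₁) (P₂ : Eu d → Eu s₂)
    (D₁ : Set (Eu s₁)) (Q : Eu d → Set (Eu s₂)) (zb : Eu d)
    (hLip₁ : ∃ K : NNReal, ∃ U ∈ 𝓝 zb, LipschitzOnWith K P₁ U)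
    (hLip₂ : ∃ K : NNReal, ∃ U ∈ 𝓝 zb, LipschitzOnWith K P₂ U)
    (hD₁ : IsClosed D₁)
    (hQ : IsClosed {p : Eu d × Eu s₂ | p.2 ∈ Q p.1})
    (hfeas₁ : P₁ zb ∈ D₁) (hfeas₂ : -P₂ zb ∈ Q zb) :
    msr (fun z => {w : Eu s₁ × Eu s₂ | P₁ z - w.1 ∈ D₁ ∧ w.2 - P₂ z ∈ Q z}) zb (0, 0)
      ↔ msr (fun z => {w : Eu s₁ × (Eu d × Eu s₂) |
          P₁ z - w.1 ∈ D₁ ∧ ((z, -P₂ z) - w.2) ∈ {p : Eu d × Eu s₂ | p.2 ∈ Q p.1}})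
          zb (0, (0, 0)) := by
  have hS : {z | P₁ z - (0 : Eu s₁) ∈ D₁ ∧ (0 : Eu s₂) - P₂ z ∈ Q z} =
      {z | P₁ z - (0 : Eu s₁) ∈ D₁ ∧
        ((z, -P₂ z) - ((0 : Eu d), (0 : Eu s₂))) ∈ {p : Eu d × Eu s₂ | p.2 ∈ Q p.1}} := by
    ext z
    simp
  have hzb : zb ∈ {z | P₁ z - (0 : Eu s₁) ∈ D₁ ∧ (0 : Eu s₂) - P₂ z ∈ Q z} := by
    simpa using ⟨hfeas₁, hfeas₂⟩
  have hzb' := hS ▸ hzb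
  rw [msr_iff_infDist (M := fun z => {w : Eu s₁ × Eu s₂ | P₁ z - w.1 ∈ D₁ ∧ w.2 - P₂ z ∈ Q z})
      (wb := (0, 0)) hzb,
    msr_iff_infDist (M := fun z => {w : Eu s₁ × (Eu d × Eu s₂) |
      P₁ z - w.1 ∈ D₁ ∧ ((z, -P₂ z) - w.2) ∈ {p : Eu d × Eu s₂ | p.2 ∈ Q p.1}})
      (wb := (0, (0, 0))) hzb']
  simp only [mem_ofPred_eq] at hS hzb hzb' ⊢
  rw [← hS]
  set S := {z | P₁ z - (0 : Eu s₁) ∈ D₁ ∧ (0 : Eu s₂) - P₂ z ∈ Q z}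
  constructor
  · rintro ⟨κ, hκ, r, hr, H⟩
    obtain ⟨K₁, U₁, hU₁, hK₁⟩ := hLip₁
    obtain ⟨K₂, U₂, hU₂, hK₂⟩ := hLip₂
    obtain ⟨ρ, hρ, hρU⟩ := Metric.mem_nhds_iff.1
      (inter_mem (Metric.ball_mem_nhds zb hr) (inter_mem hU₁ hU₂))
    have hK₁0 : (0 : ℝ) ≤ K₁ := K₁.2
    have hK₂0 : (0 : ℝ) ≤ K₂ := K₂.2
    refine ⟨1 + κ * (K₁ + K₂ + 1), by positivity, ρ / 2, by positivity, ?_⟩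
    rintro z hz ⟨w, a, b⟩ ⟨hw, hab⟩
    simp only [Prod.mk_sub_mk] at hab
    rw [Metric.mem_ball] at hz
    set t : ℝ := dist ((0 : Eu s₁), ((0 : Eu d), (0 : Eu s₂))) (w, (a, b)) with ht
    simp only [Prod.dist_eq, dist_zero_left] at ht
    have hwt : ‖w‖ ≤ t := ht ▸ le_max_left _ _
    have hat : ‖a‖ ≤ t := ht ▸ (le_max_left _ _).trans (le_max_right _ _)
    have hbt : ‖b‖ ≤ t := ht ▸ (le_max_right _ _).trans (le_max_right _ _)
    have ht0 : 0 ≤ t := (norm_nonneg w).trans hwt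
    have hza : dist z (z - a) = ‖a‖ := by simp
    rcases lt_or_ge ‖a‖ (ρ / 2) with ha | ha
    · have hz' : z - a ∈ Metric.ball zb ρ := by
        have := dist_triangle_left (z - a) zb z
        rw [Metric.mem_ball]
        linarith
      have hzU := hρU (Metric.mem_ball.2 (by linarith : dist z zb < ρ))
      have hzU' := hρU hz'
      have h₁ := hK₁.dist_le_mul _ hzU'.2.1 _ hzU.2.1
      have h₂ := hK₂.dist_le_mul _ hzU'.2.2 _ hzU.2.2
      rw [dist_comm (z - a) z, hza, dist_eq_norm] at h₁ h₂
      have hM := H (z - a) hzU'.1 (P₁ (z - a) - P₁ z + w, P₂ (z - a) - P₂ z - b)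
        ⟨by convert hw using 1; dsimp only; abel,
          by convert hab using 1; dsimp only; abel⟩
      have hd : dist ((0 : Eu s₁), (0 : Eu s₂))
          (P₁ (z - a) - P₁ z + w, P₂ (z - a) - P₂ z - b) ≤ (K₁ + K₂ + 1) * t := by
        have e₁ := norm_add_le (P₁ (z - a) - P₁ z) w
        have e₂ := norm_sub_le (P₂ (z - a) - P₂ z) b
        have g₁ := mul_le_mul_of_nonneg_left hat hK₁0
        have g₂ := mul_le_mul_of_nonneg_left hat hK₂0
        have k₁ := mul_nonneg hK₁0 ht0
        have k₂ := mul_nonneg hK₂0 ht0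
        simp only [Prod.dist_eq, dist_zero_left]
        exact max_le (by linarith) (by linarith)
      have hM' := hM.trans (mul_le_mul_of_nonneg_left hd hκ.le)
      have := Metric.infDist_le_infDist_add_dist (s := S) (x := z) (y := z - a)
      rw [hza] at this
      linarith
    · have h₁ : Metric.infDist z S ≤ dist z zb := Metric.infDist_le_dist_of_mem hzb
      have h₂ : 0 ≤ κ * (K₁ + K₂ + 1) * t := by positivity
      linarith
  · rintro ⟨κ, hκ, r, hr, H⟩
    refine ⟨κ, hκ, r, hr, ?_⟩
    rintro z hz ⟨w, b⟩ ⟨hw, hb⟩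
    refine (H z hz (w, (0, -b)) ⟨hw, ?_⟩).trans_eq ?_
    · simpa [neg_add_eq_sub] using hb
    · simp [Prod.dist_eq]
end
end

section
/- (Second-order sufficient condition for metric subregularity, SOSCMS) Let P: ℝ^d → ℝ^s be twice Fréchet differentiable at z̄ with P(z̄) ∈ ℝ^s_- and set Ω := {z | P(z) ≤ 0}. If for every nonzero w ∈ T^lin_Ω(z̄) := {w | ∇P(z̄)w ∈ T_{ℝ^s_-}(P(z̄))} the implication [∇P(z̄)^T λ = 0, λ ∈ N_{ℝ^s_-}(P(z̄)), and w^T ∇²(λ^T P)(z̄) w ≥ 0] ⟹ λ = 0 holds, then the map M(z) := P(z) − ℝ^s_- is metrically subregular at (z̄, 0), i.e., the metric subregularity constraint qualification holds at z̄ for the system P(z) ≤ 0. -/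
open Filter Topology Set
open scoped RealInnerProductSpace

noncomputable section

/-- The projection of `y` onto the nonnegative orthant. -/
def posVec {s : ℕ} (y : Eu s) : Eu s := WithLp.toLp 2 fun i => max (y i) 0

theorem posVec_apply {s : ℕ} (y : Eu s) (i : Fin s) : posVec y i = max (y i) 0 := rfl

theorem posVec_eq_zero_iff {s : ℕ} (y : Eu s) : posVec y = 0 ↔ ∀ i, y i ≤ 0 := by
  constructor
  · intro h i
    have := congrArg (fun v : Eu s => v i) h
    simpa [posVec_apply] using this
  · intro h
    ext i
    simpa [posVec_apply] using h i

theorem continuous_posVec {s : ℕ} : Continuous (posVec (s := s)) := by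
  unfold posVec
  fun_prop

theorem hasDerivAt_sq_max_zero (x : ℝ) :
    HasDerivAt (fun x : ℝ => (max x 0) ^ 2) (2 * max x 0) x := by
  rcases lt_trichotomy x 0 with h | rfl | h
  · have : (fun x : ℝ => (max x 0) ^ 2) =ᶠ[𝓝 x] fun _ => 0 := by
      filter_upwards [gt_mem_nhds h] with y hy
      simp [max_eq_right hy.le]
    simpa [max_eq_right h.le] using (hasDerivAt_const x (0 : ℝ)).congr_of_eventuallyEq this
  · rw [hasDerivAt_iff_isLittleO_nhds_zero]
    have h2 : (fun h : ℝ => h ^ 2) =o[𝓝 0] fun h => h := by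
      simpa using Asymptotics.isLittleO_pow_id (𝕜 := ℝ) (one_lt_two)
    refine Asymptotics.IsBigO.trans_isLittleO (Asymptotics.IsBigO.of_bound 1 ?_) h2
    refine Eventually.of_forall fun h => ?_
    rcases le_total h 0 with hh | hh <;> simp [hh, sq_nonneg]
  · have : (fun x : ℝ => (max x 0) ^ 2) =ᶠ[𝓝 x] fun x => x ^ 2 := by
      filter_upwards [lt_mem_nhds h] with y hy
      simp [max_eq_left hy.le]
    simpa [max_eq_left h.le] using (hasDerivAt_pow 2 x).congr_of_eventuallyEq this

theorem hasFDerivAt_norm_posVec {s : ℕ} (y : Eu s) (hy : posVec y ≠ 0) :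
    HasFDerivAt (fun y : Eu s => ‖posVec y‖) (‖posVec y‖⁻¹ • innerSL ℝ (posVec y)) y := by
  have h1 : ∀ y : Eu s, ‖posVec y‖ = √(∑ i, (max (y i) 0) ^ 2) := fun y => by
    rw [EuclideanSpace.norm_eq]
    simp [posVec_apply]
  have h2 : HasFDerivAt (fun y : Eu s => ∑ i, (max (y i) 0) ^ 2)
      (∑ i, (2 * max (y i) 0) • (EuclideanSpace.proj i : Eu s →L[ℝ] ℝ)) y := by
    refine HasFDerivAt.fun_sum fun i _ => ?_
    exact (hasDerivAt_sq_max_zero (y i)).comp_hasFDerivAt y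
      (EuclideanSpace.proj i : Eu s →L[ℝ] ℝ).hasFDerivAt
  have hne : ∑ i, (max (y i) 0) ^ 2 ≠ 0 := by
    intro h
    apply hy
    rw [← norm_eq_zero, h1, h, Real.sqrt_zero]
  have h3 := h2.sqrt hne
  simp_rw [← h1] at h3
  refine h3.congr_fderiv (ContinuousLinearMap.ext fun v => ?_)
  simp only [smul_apply, innerSL_apply_apply, PiLp.inner_apply, sum_apply,
    PiLp.proj_apply, smul_eq_mul, posVec_apply, Finset.mul_sum]
  refine Finset.sum_congr rfl fun i _ => ?_
  have : ‖posVec y‖ ≠ 0 := norm_ne_zero_iff.2 hy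
  simp
  field_simp

/-- If `f + ε‖· - a‖` has a local minimum at `x`, then the derivative of `f` at `x` is bounded
by `ε` in norm. -/
theorem abs_fderiv_le_of_isLocalMin_add_norm {E : Type*} [NormedAddCommGroup E] [NormedSpace ℝ E]
    {f : E → ℝ} {L : E →L[ℝ] ℝ} {x a : E} {ε : ℝ} (hε : 0 ≤ ε) (hf : HasFDerivAt f L x)
    (hmin : IsLocalMin (fun z => f z + ε * ‖z - a‖) x) (h : E) : |L h| ≤ ε * ‖h‖ := by
  have key : ∀ h : E, -(ε * ‖h‖) ≤ L h := by
    intro h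
    have hl := hf.hasLineDerivAt h
    have ht := HasDerivAt.tendsto_slope_zero_right hl
    refine ge_of_tendsto ht ?_
    have hc : Tendsto (fun t : ℝ => x + t • h) (𝓝[>] 0) (𝓝 x) := by
      have : Continuous fun t : ℝ => x + t • h := by fun_prop
      simpa using (this.tendsto 0).mono_left nhdsWithin_le_nhds
    filter_upwards [hc.eventually hmin, self_mem_nhdsWithin] with t h1 h2
    have ht0 : (0 : ℝ) < t := h2
    simp only [zero_add, zero_smul, add_zero, smul_eq_mul]
    rw [le_inv_mul_iff₀ ht0]
    have h3 : ‖x + t • h - a‖ ≤ ‖x - a‖ + t * ‖h‖ := by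
      calc ‖x + t • h - a‖ = ‖(x - a) + t • h‖ := by congr 1; abel
        _ ≤ _ := by
          refine (norm_add_le _ _).trans ?_
          rw [norm_smul, Real.norm_of_nonneg ht0.le]
    nlinarith [mul_le_mul_of_nonneg_left h3 hε]
  rw [abs_le]
  refine ⟨key h, ?_⟩
  have := key (-h)
  rw [norm_neg, map_neg] at this
  linarith

theorem norm_posVec_le_infEDist {s : ℕ} (y : Eu s) :
    ENNReal.ofReal ‖posVec y‖ ≤ Metric.infEDist 0 {w : Eu s | ∀ i, y i - w i ≤ 0} := by
  refine Metric.le_infEDist.2 fun w hw => ?_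
  rw [edist_dist, dist_zero_left]
  refine ENNReal.ofReal_le_ofReal ?_
  rw [EuclideanSpace.norm_eq, EuclideanSpace.norm_eq]
  refine Real.sqrt_le_sqrt (Finset.sum_le_sum fun i _ => ?_)
  refine pow_le_pow_left₀ (norm_nonneg _) ?_ 2
  rw [posVec_apply, Real.norm_of_nonneg (le_max_right _ _)]
  have := hw i
  exact max_le (by linarith [le_abs_self (w i), Real.norm_eq_abs (w i)]) (norm_nonneg _)

/-- Failure of metric subregularity produces nearly stationary infeasible points of the
residual `‖posVec (P ·)‖` arbitrarily close to the reference point. -/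
theorem exists_nearly_stationary_of_not_msr {d s : ℕ} {P : Eu d → Eu s} {zb : Eu d}
    (hdiff : ∃ U ∈ 𝓝 zb, ∀ z ∈ U, DifferentiableAt ℝ P z) (hz : ∀ i, P zb i ≤ 0)
    (hn : ¬ msr (fun z => {w : Eu s | ∀ i, P z i - w i ≤ 0}) zb 0) {ε : ℝ} (hε : 0 < ε) :
    ∃ z, ‖z - zb‖ < ε ∧ posVec (P z) ≠ 0 ∧ ‖posVec (P z)‖ ≤ ε * ‖z - zb‖ ∧
      ∀ h, |⟪posVec (P z), fderiv ℝ P z h⟫| ≤ ε * ‖posVec (P z)‖ * ‖h‖ := by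
  obtain ⟨U, hU, hd⟩ := hdiff
  obtain ⟨ρ, hρ, hρU⟩ := Metric.mem_nhds_iff.1 hU
  set δ := min ε ρ / 2 with hδ
  have hδ0 : 0 < δ := by positivity
  have hδε : 2 * δ ≤ ε := by rw [hδ]; linarith [min_le_left ε ρ]
  have hδρ : 2 * δ ≤ ρ := by rw [hδ]; linarith [min_le_right ε ρ]
  unfold msr at hn
  push Not at hn
  obtain ⟨z₀, hz₀, hlt⟩ := hn (4 / ε) (by positivity) (Metric.ball zb δ)
    (Metric.ball_mem_nhds _ hδ0)
  set Ω : Set (Eu d) := {z' | (0 : Eu s) ∈ {w : Eu s | ∀ i, P z' i - w i ≤ 0}} with hΩ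
  have hΩmem : ∀ z, z ∈ Ω ↔ posVec (P z) = 0 := fun z => by
    rw [posVec_eq_zero_iff]; simp [hΩ]
  have hzbΩ : zb ∈ Ω := by rw [hΩmem, posVec_eq_zero_iff]; exact hz
  set D := Metric.infDist z₀ Ω with hD
  have hDle : ∀ z ∈ Ω, D ≤ ‖z₀ - z‖ := fun z hz => by
    rw [← dist_eq_norm]; exact Metric.infDist_le_dist_of_mem hz
  have hDf : 4 / ε * ‖posVec (P z₀)‖ < D := by
    have h1 : ENNReal.ofReal (4 / ε * ‖posVec (P z₀)‖) < ENNReal.ofReal D := by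
      rw [ENNReal.ofReal_mul (by positivity), hD, Metric.infDist,
        ENNReal.ofReal_toReal (Metric.infEDist_ne_top ⟨zb, hzbΩ⟩)]
      refine lt_of_le_of_lt ?_ hlt
      gcongr
      exact norm_posVec_le_infEDist _
    exact (ENNReal.ofReal_lt_ofReal_iff_of_nonneg (by positivity)).1 h1
  have hD0 : 0 < D := lt_of_le_of_lt (by positivity) hDf
  have hfD : ‖posVec (P z₀)‖ < ε * D / 4 := by
    rw [div_mul_eq_mul_div, div_lt_iff₀ hε] at hDf
    linarith
  have hz₀δ : ‖z₀ - zb‖ < δ := by rw [← dist_eq_norm]; exact hz₀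
  have hDzb := hDle zb hzbΩ
  have hnear : ∀ z ∈ Metric.closedBall z₀ (D / 2), ‖z - zb‖ < 2 * δ := fun z hz => by
    rw [Metric.mem_closedBall, dist_eq_norm] at hz
    have := norm_sub_le_norm_sub_add_norm_sub z z₀ zb
    linarith
  have hdz : ∀ z ∈ Metric.closedBall z₀ (D / 2), DifferentiableAt ℝ P z := fun z hz =>
    hd z (hρU (by rw [Metric.mem_ball, dist_eq_norm]; linarith [hnear z hz]))
  have hcont : ContinuousOn (fun z => ‖posVec (P z)‖ + ε * ‖z - z₀‖)
      (Metric.closedBall z₀ (D / 2)) := by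
    refine ContinuousOn.add ?_ (by fun_prop)
    exact (continuous_norm.comp continuous_posVec).comp_continuousOn
      fun z hz => (hdz z hz).continuousAt.continuousWithinAt
  obtain ⟨z, hzB, hzmin⟩ := (isCompact_closedBall z₀ (D / 2)).exists_isMinOn
    ⟨z₀, Metric.mem_closedBall_self (by positivity)⟩ hcont
  have hle : ‖posVec (P z)‖ + ε * ‖z - z₀‖ ≤ ‖posVec (P z₀)‖ := by
    have h0 : z₀ ∈ Metric.closedBall z₀ (D / 2) := Metric.mem_closedBall_self (by positivity)
    have := hzmin h0
    simpa using this
  have hzz₀ : ‖z - z₀‖ < D / 4 := by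
    have : ε * ‖z - z₀‖ < ε * (D / 4) := by linarith [norm_nonneg (posVec (P z))]
    exact lt_of_mul_lt_mul_left this hε.le
  have hzne : posVec (P z) ≠ 0 := fun h => by
    have := hDle z ((hΩmem z).2 h)
    rw [norm_sub_rev] at this
    linarith
  have hloc : IsLocalMin (fun z => ‖posVec (P z)‖ + ε * ‖z - z₀‖) z :=
    hzmin.isLocalMin (Metric.closedBall_mem_nhds_of_mem
      (by rw [Metric.mem_ball, dist_eq_norm]; linarith))
  have hder := (hasFDerivAt_norm_posVec (P z) hzne).comp z (hdz z hzB).hasFDerivAt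
  refine ⟨z, by linarith [hnear z hzB], hzne, ?_, fun h => ?_⟩
  · have h1 := norm_sub_le_norm_sub_add_norm_sub z₀ z zb
    rw [norm_sub_rev z₀ z] at h1
    have : D / 4 ≤ ‖z - zb‖ := by linarith
    have h2 := mul_le_mul_of_nonneg_left this hε.le
    have : 0 ≤ ε * ‖z - z₀‖ := by positivity
    linarith
  · have h1 := abs_fderiv_le_of_isLocalMin_add_norm hε.le hder hloc h
    have hp : 0 < ‖posVec (P z)‖ := norm_pos_iff.2 hzne
    simp only [ContinuousLinearMap.comp_apply, smul_apply,
      innerSL_apply_apply, smul_eq_mul, abs_mul, abs_inv, abs_norm] at h1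
    rw [inv_mul_le_iff₀ hp] at h1
    linarith

theorem tendsto_clm_apply {α E F : Type*} [NormedAddCommGroup E] [NormedSpace ℝ E]
    [NormedAddCommGroup F] [NormedSpace ℝ F] {f : Filter α} {T : α → E →L[ℝ] F} {v : α → E}
    {T₀ : E →L[ℝ] F} {v₀ : E} (hT : Tendsto T f (𝓝 T₀)) (hv : Tendsto v f (𝓝 v₀)) :
    Tendsto (fun a => T a (v a)) f (𝓝 (T₀ v₀)) :=
  (isBoundedBilinearMap_apply.continuous.tendsto (T₀, v₀)).comp (hT.prodMk_nhds hv)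

theorem inner_fderiv_adjoint_fderiv {d s : ℕ} {P : Eu d → Eu s} {zb : Eu d}
    (hdiff2 : DifferentiableAt ℝ (fderiv ℝ P) zb) (l : Eu s) (w : Eu d) :
    ⟪w, fderiv ℝ (fun z => ContinuousLinearMap.adjoint (fderiv ℝ P z) l) zb w⟫ =
      ⟪l, fderiv ℝ (fderiv ℝ P) zb w w⟫ := by
  let A : (Eu d →L[ℝ] Eu s) →ₗ[ℝ] Eu d :=
    { toFun := fun T => ContinuousLinearMap.adjoint T l
      map_add' := fun S T => by simp
      map_smul' := fun c T => by simp }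
  have h := (LinearMap.toContinuousLinearMap A).hasFDerivAt.comp zb hdiff2.hasFDerivAt
  have h' : HasFDerivAt (fun z => ContinuousLinearMap.adjoint (fderiv ℝ P z) l)
      ((LinearMap.toContinuousLinearMap A).comp (fderiv ℝ (fderiv ℝ P) zb)) zb := h
  rw [h'.fderiv]
  change ⟪w, ContinuousLinearMap.adjoint (fderiv ℝ (fderiv ℝ P) zb w) l⟫ = _
  rw [ContinuousLinearMap.adjoint_inner_right, real_inner_comm]

/-- A vanishing first-order term together with nonnegativity of the increments of `⟪l, P ·⟫` along
a sequence tangent to `w` forces nonnegative curvature in the direction `w`. -/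
theorem inner_second_fderiv_nonneg {E F : Type*} [NormedAddCommGroup E] [NormedSpace ℝ E]
    [NormedAddCommGroup F] [InnerProductSpace ℝ F] {P : E → F} {zb w : E} {l : F}
    (hdiff : ∀ᶠ z in 𝓝 zb, DifferentiableAt ℝ P z)
    (hdiff2 : DifferentiableAt ℝ (fderiv ℝ P) zb)
    (hcrit : ∀ h, ⟪l, fderiv ℝ P zb h⟫ = 0) {z : ℕ → E}
    (hz : Tendsto z atTop (𝓝 zb))
    (hw : Tendsto (fun n => ‖z n - zb‖⁻¹ • (z n - zb)) atTop (𝓝 w))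
    (hP : ∀ᶠ n in atTop, ⟪l, P zb⟫ ≤ ⟪l, P (z n)⟫) :
    0 ≤ ⟪l, fderiv ℝ (fderiv ℝ P) zb w w⟫ := by
  obtain ⟨ρ, hρ, hρU⟩ := Metric.eventually_nhds_iff_ball.1 hdiff
  have hmvt : ∀ᶠ n in atTop, ∃ θ : ℝ, θ ∈ Ioo (0 : ℝ) 1 ∧
      0 ≤ ⟪l, fderiv ℝ P (zb + θ • (z n - zb)) (z n - zb)⟫ := by
    filter_upwards [hP, hz.eventually (Metric.ball_mem_nhds zb hρ)] with n hn hball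
    have hd : ∀ t ∈ Icc (0 : ℝ) 1, HasDerivAt (fun t : ℝ => ⟪l, P (zb + t • (z n - zb))⟫)
        ⟪l, fderiv ℝ P (zb + t • (z n - zb)) (z n - zb)⟫ t := by
      intro t ht
      have hmem : zb + t • (z n - zb) ∈ Metric.ball zb ρ :=
        (convex_ball zb ρ).add_smul_sub_mem (Metric.mem_ball_self hρ) hball ht
      have h1 : HasDerivAt (fun t : ℝ => zb + t • (z n - zb)) (z n - zb) t := by
        simpa using ((hasDerivAt_id t).smul_const (z n - zb)).const_add zb
      have h2 := (hρU _ hmem).hasFDerivAt.comp_hasDerivAt t h1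
      exact (innerSL ℝ l).hasFDerivAt.comp_hasDerivAt t h2
    obtain ⟨θ, hθ, hθe⟩ := exists_hasDerivAt_eq_slope _ _ zero_lt_one
      (fun t ht => (hd t ht).continuousAt.continuousWithinAt)
      (fun t ht => hd t (Ioo_subset_Icc_self ht))
    refine ⟨θ, hθ, ?_⟩
    rw [hθe]
    simpa using hn
  obtain ⟨θ, hθ⟩ := hmvt.choice
  have hsub : Tendsto (fun n => z n - zb) atTop (𝓝 0) := by
    simpa using hz.sub_const zb
  have hdlim : Tendsto (fun n => θ n • (z n - zb)) atTop (𝓝 0) := by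
    refine squeeze_zero_norm' ?_ (tendsto_zero_iff_norm_tendsto_zero.1 hsub)
    filter_upwards [hθ] with n hn
    rw [norm_smul, Real.norm_of_nonneg hn.1.1.le]
    exact mul_le_of_le_one_left (norm_nonneg _) hn.1.2.le
  have hcd : Tendsto (fun n => (θ n * ‖z n - zb‖)⁻¹ • (θ n • (z n - zb))) atTop (𝓝 w) := by
    refine hw.congr' ?_
    filter_upwards [hθ] with n hn
    have := hn.1.1.ne'
    rw [smul_smul, mul_inv, mul_right_comm, inv_mul_cancel₀ this, one_mul]
  have hlim := hdiff2.hasFDerivAt.hasFDerivWithinAt (s := univ) |>.lim hdlim (by simp) hcd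
  refine ge_of_tendsto (tendsto_const_nhds.inner (tendsto_clm_apply hlim hw)) ?_
  filter_upwards [hθ] with n hn
  have hpos : 0 < θ n := hn.1.1
  simp only [smul_apply, sub_apply, map_smul, inner_smul_right, inner_sub_right, hcrit, sub_zero]
  have := hn.2
  positivity

/-- SOSCMS: let `P` be twice Fréchet differentiable at `zb` with `P(zb) ≤ 0`.
If for every nonzero `w` with `∇P(zb)w ∈ T_{ℝ^s₋}(P(zb))` one has
`[∇P(zb)ᵀλ = 0, λ ∈ N_{ℝ^s₋}(P(zb)), wᵀ∇²(λᵀP)(zb)w ≥ 0] ⟹ λ = 0`, then the map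
`M(z) = P(z) − ℝ^s₋` is metrically subregular at `(zb, 0)`.
Here `wᵀ∇²(λᵀP)(zb)w` is written as `⟪w, D(z ↦ ∇P(z)ᵀλ)(zb) w⟫`. -/
theorem stmt_6 {d s : ℕ} (P : Eu d → Eu s) (zb : Eu d)
    (hdiff : ∃ U ∈ 𝓝 zb, ∀ z ∈ U, DifferentiableAt ℝ P z)
    (hdiff2 : DifferentiableAt ℝ (fderiv ℝ P) zb)
    (hz : ∀ i, P zb i ≤ 0)
    (hSOSCMS : ∀ w : Eu d, w ≠ 0 →
      (∀ i, P zb i = 0 → fderiv ℝ P zb w i ≤ 0) →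
      ∀ l : Eu s, ContinuousLinearMap.adjoint (fderiv ℝ P zb) l = 0 →
        (∀ i, 0 ≤ l i) → (∀ i, P zb i < 0 → l i = 0) →
        0 ≤ ⟪w, fderiv ℝ (fun z => ContinuousLinearMap.adjoint (fderiv ℝ P z) l) zb w⟫ →
        l = 0) :
    msr (fun z => {w : Eu s | ∀ i, P z i - w i ≤ 0}) zb 0 := by
  by_contra hn
  have hstat := fun n : ℕ =>
    exists_nearly_stationary_of_not_msr hdiff hz hn (Nat.one_div_pos_of_nat (α := ℝ) (n := n))
  choose z hzε hzne hzf hzg using hstat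
  have hzb0 : posVec (P zb) = 0 := (posVec_eq_zero_iff _).2 hz
  have hzzb : ∀ n, z n ≠ zb := fun n h => hzne n (h ▸ hzb0)
  have hτ : ∀ n, ‖z n - zb‖ ≠ 0 := fun n => norm_ne_zero_iff.2 (sub_ne_zero.2 (hzzb n))
  have hp : ∀ n, 0 < ‖posVec (P (z n))‖ := fun n => norm_pos_iff.2 (hzne n)
  obtain ⟨⟨w, l⟩, hwl, φ, hφ, hlim⟩ :=
    ((isCompact_sphere (0 : Eu d) 1).prod (isCompact_sphere (0 : Eu s) 1)).tendsto_subseq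
    (x := fun n => (‖z n - zb‖⁻¹ • (z n - zb), ‖posVec (P (z n))‖⁻¹ • posVec (P (z n))))
    (fun n => by simp [norm_smul, hτ n, (hp n).ne'])
  have hw : Tendsto (fun n => ‖z (φ n) - zb‖⁻¹ • (z (φ n) - zb)) atTop (𝓝 w) :=
    (continuous_fst.tendsto _).comp hlim
  have hl : Tendsto (fun n => ‖posVec (P (z (φ n)))‖⁻¹ • posVec (P (z (φ n)))) atTop (𝓝 l) :=
    (continuous_snd.tendsto _).comp hlim
  have hw1 : ‖w‖ = 1 := by simpa using hwl.1
  have hl1 : ‖l‖ = 1 := by simpa using hwl.2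
  have hε : Tendsto (fun n => 1 / ((φ n : ℝ) + 1)) atTop (𝓝 0) :=
    tendsto_one_div_add_atTop_nhds_zero_nat.comp hφ.tendsto_atTop
  have hsub : Tendsto (fun n => z (φ n) - zb) atTop (𝓝 0) :=
    squeeze_zero_norm (fun n => (hzε (φ n)).le) hε
  have hzlim : Tendsto (fun n => z (φ n)) atTop (𝓝 zb) := by
    simpa using hsub.add_const zb
  have hli : ∀ i, Tendsto (fun n => ‖posVec (P (z (φ n)))‖⁻¹ * max (P (z (φ n)) i) 0) atTop
      (𝓝 (l i)) := fun i =>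
    ((EuclideanSpace.proj i : Eu s →L[ℝ] ℝ).continuous.tendsto l).comp hl
  have hdP : DifferentiableAt ℝ P zb := by
    obtain ⟨U, hU, hd⟩ := hdiff
    exact hd zb (mem_of_mem_nhds hU)
  have htan : ∀ i, P zb i = 0 → fderiv ℝ P zb w i ≤ 0 := by
    intro i hi
    have h1 := hdP.hasFDerivAt.hasFDerivWithinAt (s := univ) |>.lim hsub (by simp) hw
    have h2 := ((EuclideanSpace.proj i : Eu s →L[ℝ] ℝ).continuous.tendsto _).comp h1
    refine le_of_tendsto_of_tendsto' h2 hε fun n => ?_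
    have h3 : P (z (φ n)) i ≤ ‖posVec (P (z (φ n)))‖ :=
      (le_max_left _ 0).trans ((le_abs_self _).trans
        (PiLp.norm_apply_le (posVec (P (z (φ n)))) i))
    have h4 : 0 < ‖z (φ n) - zb‖ := (norm_nonneg _).lt_of_ne' (hτ _)
    simp only [Function.comp_apply, PiLp.proj_apply, add_sub_cancel, PiLp.smul_apply,
      PiLp.sub_apply, hi, sub_zero, smul_eq_mul]
    rw [inv_mul_le_iff₀ h4]
    linarith [hzf (φ n)]
  have hcrit : ∀ h, ⟪l, fderiv ℝ P zb h⟫ = 0 := by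
    intro h
    have h1 : Tendsto (fun n => fderiv ℝ P (z (φ n)) h) atTop (𝓝 (fderiv ℝ P zb h)) :=
      tendsto_clm_apply (hdiff2.continuousAt.tendsto.comp hzlim) tendsto_const_nhds
    have h2 : Tendsto (fun n => 1 / ((φ n : ℝ) + 1) * ‖h‖) atTop (𝓝 0) := by
      simpa using hε.mul_const ‖h‖
    refine tendsto_nhds_unique (hl.inner h1) (squeeze_zero_norm (fun n => ?_) h2)
    rw [real_inner_smul_left, norm_mul, norm_inv, norm_norm, inv_mul_le_iff₀ (hp _)]
    linarith [hzg (φ n) h, Real.norm_eq_abs ⟪posVec (P (z (φ n))), fderiv ℝ P (z (φ n)) h⟫]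
  have hlnonneg : ∀ i, 0 ≤ l i := fun i => ge_of_tendsto' (hli i) fun n => by positivity
  have hlcompl : ∀ i, P zb i < 0 → l i = 0 := by
    intro i hi
    have h1 : Tendsto (fun n => P (z (φ n)) i) atTop (𝓝 (P zb i)) :=
      ((EuclideanSpace.proj i : Eu s →L[ℝ] ℝ).continuous.tendsto _).comp
        (hdP.continuousAt.tendsto.comp hzlim)
    refine tendsto_nhds_unique (hli i) (tendsto_const_nhds.congr' ?_)
    filter_upwards [h1.eventually (gt_mem_nhds hi)] with n hn
    rw [max_eq_right hn.le, mul_zero]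
  have hgrow : ∀ᶠ n in atTop, ⟪l, P zb⟫ ≤ ⟪l, P (z (φ n))⟫ := by
    have h1 : ∀ i, ∀ᶠ n in atTop, 0 ≤ l i * P (z (φ n)) i := by
      intro i
      rcases (hlnonneg i).eq_or_lt with h | h
      · simp [← h]
      · filter_upwards [(hli i).eventually (lt_mem_nhds h)] with n hn
        refine mul_nonneg h.le (le_of_not_gt fun hneg => ?_)
        rw [max_eq_right hneg.le, mul_zero] at hn
        exact lt_irrefl _ hn
    filter_upwards [eventually_all.2 h1] with n hn
    have h0 : ⟪l, P zb⟫ = 0 := by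
      rw [PiLp.inner_apply]
      refine Finset.sum_eq_zero fun i _ => ?_
      rcases (hz i).eq_or_lt with h | h
      · simp [h]
      · simp [hlcompl i h]
    rw [h0, PiLp.inner_apply]
    refine Finset.sum_nonneg fun i _ => ?_
    simpa [mul_comm] using hn i
  have hl0 : l = 0 := by
    refine hSOSCMS w (norm_ne_zero_iff.1 (by simp [hw1])) htan l ?_ hlnonneg hlcompl ?_
    · refine ext_inner_right ℝ fun h => ?_
      rw [ContinuousLinearMap.adjoint_inner_left, hcrit, inner_zero_left]
    · rw [inner_fderiv_adjoint_fderiv hdiff2]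
      obtain ⟨U, hU, hd⟩ := hdiff
      exact inner_second_fderiv_nonneg (mem_of_superset hU hd) hdiff2 hcrit hzlim hw hgrow
  simp [hl0] at hl1
end
end

section
/- Let P: ℝ^d → ℝ^s be continuously differentiable, D ⊂ ℝ^s closed, z̄ ∈ Ω := {z | P(z) ∈ D}, and assume the metric subregularity constraint qualification holds at z̄ for the system P(z) ∈ D (i.e., M(z) := P(z) − D is metrically subregular at (z̄, 0)). Then N̂_Ω(z̄) ⊆ N_Ω(z̄) ⊆ ∇P(z̄)^T N_D(P(z̄)) := {∇P(z̄)^T λ | λ ∈ N_D(P(z̄))}. -/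
open Filter Topology Set
open scoped RealInnerProductSpace

noncomputable section

/-- The (Fréchet) regular normal cone to `Ω` at `zb`. -/
def rnc {E : Type*} [NormedAddCommGroup E] [InnerProductSpace ℝ E]
    (Ω : Set E) (zb : E) : Set E :=
  {v | ∀ ε > (0 : ℝ), ∃ δ > (0 : ℝ), ∀ z ∈ Ω, ‖z - zb‖ < δ →
    ⟪v, z - zb⟫ ≤ ε * ‖z - zb‖}

/-- The (Mordukhovich) limiting normal cone to `Ω` at `zb`. -/
def lnc {E : Type*} [NormedAddCommGroup E] [InnerProductSpace ℝ E]
    (Ω : Set E) (zb : E) : Set E :=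
  {v | ∃ z : ℕ → E, ∃ w : ℕ → E, (∀ k, z k ∈ Ω) ∧ Tendsto z atTop (𝓝 zb) ∧
    Tendsto w atTop (𝓝 v) ∧ ∀ k, w k ∈ rnc Ω (z k)}

/-- Metric subregularity of `x ↦ P x - D` yields a local error bound for `P x ∈ D`. -/
theorem msr.exists_infDist_le {E F : Type*} [NormedAddCommGroup E] [NormedAddCommGroup F]
    {P : E → F} {D : Set F} {z : E} (h : msr (fun x => {w | P x - w ∈ D}) z 0) :
    ∃ κ > 0, ∀ᶠ x in 𝓝 z, ∀ y ∈ D, Metric.infDist x {x | P x ∈ D} ≤ κ * ‖P x - y‖ := by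
  obtain ⟨κ, hκ, W, hW, hb⟩ := h
  refine ⟨κ, hκ, ?_⟩
  filter_upwards [hW] with x hx y hy
  have h1 := hb x hx
  simp only [mem_ofPred_eq, sub_zero] at h1
  have h2 : Metric.infEDist (0 : F) {w | P x - w ∈ D} ≤ ENNReal.ofReal ‖P x - y‖ := by
    refine (Metric.infEDist_le_edist_of_mem (y := P x - y) (by simpa using hy)).trans ?_
    rw [edist_dist, dist_zero_left]
  have h3 := h1.trans (mul_le_mul_right h2 _)
  rw [← ENNReal.ofReal_mul hκ.le] at h3
  exact ENNReal.toReal_le_of_le_ofReal (by positivity) h3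

section NormalCone

variable {E F : Type*} [NormedAddCommGroup E] [InnerProductSpace ℝ E]
  [NormedAddCommGroup F] [InnerProductSpace ℝ F]

theorem rnc_subset_lnc {Ω : Set E} {z : E} (hz : z ∈ Ω) : rnc Ω z ⊆ lnc Ω z :=
  fun v hv => ⟨fun _ => z, fun _ => v, fun _ => hz, tendsto_const_nhds, tendsto_const_nhds,
    fun _ => hv⟩

/-- A function that decreases at most at rate `ε` around a point of differentiability has
derivative bounded below by `-ε ‖h‖`. -/
theorem HasFDerivAt.neg_mul_norm_le_of_eventually {g : E → ℝ} {g' : E →L[ℝ] ℝ} {x : E} {ε : ℝ}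
    (hg : HasFDerivAt g g' x) (hmin : ∀ᶠ u in 𝓝 x, g x - ε * ‖u - x‖ ≤ g u) (h : E) :
    -(ε * ‖h‖) ≤ g' h := by
  have key : ∀ c > (0 : ℝ), -((ε + c) * ‖h‖) ≤ g' h := by
    intro c hc
    have hev : ∀ᶠ u in 𝓝 x, -((ε + c) * ‖u - x‖) ≤ g' (u - x) := by
      filter_upwards [hmin, hg.isLittleO.def hc] with u h1 h2
      have := (abs_le.1 (Real.norm_eq_abs _ ▸ h2)).2
      linarith
    have hlim : Tendsto (fun t : ℝ => x + t • h) (𝓝[>] 0) (𝓝 x) := by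
      have : Continuous fun t : ℝ => x + t • h := by fun_prop
      simpa using (this.tendsto 0).mono_left nhdsWithin_le_nhds
    obtain ⟨t, ht, ht0⟩ := ((hlim.eventually hev).and self_mem_nhdsWithin).exists
    have ht0 : 0 < t := ht0
    simp only [add_sub_cancel_left, norm_smul, Real.norm_eq_abs, _root_.abs_of_pos ht0, map_smul,
      smul_eq_mul] at ht
    refine le_of_mul_le_mul_left ?_ ht0
    linarith
  by_contra! hlt
  rcases (norm_nonneg h).eq_or_lt with h0 | h0
  · have := key 1 one_pos
    rw [← h0] at this hlt
    linarith
  · have := key ((-(ε * ‖h‖) - g' h) / (2 * ‖h‖)) (by apply div_pos <;> linarith)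
    have e : (-(ε * ‖h‖) - g' h) / (2 * ‖h‖) * ‖h‖ = (-(ε * ‖h‖) - g' h) / 2 := by
      field_simp
    rw [add_mul, e] at this
    linarith

/-- A local minimizer over `D` of a sum of two weighted squared distances has the negative
gradient in the regular normal cone of `D`. -/
theorem mem_rnc_of_isLocalMinOn_sq_dist {D : Set F} {p q y : F} {N δ : ℝ} (hN : 0 < N)
    (hδ : 0 < δ)
    (hmin : ∀ u ∈ D, ‖u - y‖ < δ →
      N * ‖p - y‖ ^ 2 + ‖y - q‖ ^ 2 ≤ N * ‖p - u‖ ^ 2 + ‖u - q‖ ^ 2) :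
    (2 * N) • (p - y) - (2 : ℝ) • (y - q) ∈ rnc D y := by
  intro ε hε
  refine ⟨min δ (ε / (N + 1)), lt_min hδ (by positivity), fun u hu hlt => ?_⟩
  have h1 := hmin u hu (hlt.trans_le (min_le_left _ _))
  have h2 : ‖u - y‖ * (N + 1) < ε := (lt_div_iff₀ (by positivity)).1
    (hlt.trans_le (min_le_right _ _))
  have e1 : ‖p - u‖ ^ 2 = ‖p - y‖ ^ 2 - 2 * ⟪p - y, u - y⟫ + ‖u - y‖ ^ 2 := by
    rw [← norm_sub_sq_real]; congr 2; abel
  have e2 : ‖u - q‖ ^ 2 = ‖y - q‖ ^ 2 + 2 * ⟪y - q, u - y⟫ + ‖u - y‖ ^ 2 := by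
    rw [← norm_add_sq_real]; congr 2; abel
  rw [e1, e2] at h1
  rw [inner_sub_left, real_inner_smul_left, real_inner_smul_left]
  nlinarith [norm_nonneg (u - y)]

/-- Exact penalization of a regular normal under an error bound. -/
theorem exists_penalty_of_mem_rnc [FiniteDimensional ℝ E] {G : Type*} [NormedAddCommGroup G]
    {P : E → G} {D : Set G} {z w : E} {κ ε : ℝ} (hΩ : IsClosed {x | P x ∈ D}) (hz : P z ∈ D) (hw : w ∈ rnc {x | P x ∈ D} z)
    (hε : 0 < ε)
    (hreg : ∀ᶠ x in 𝓝 z, ∀ y ∈ D, Metric.infDist x {x | P x ∈ D} ≤ κ * ‖P x - y‖) :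
    ∃ δ > 0, ∀ x, ‖x - z‖ ≤ δ → ∀ y ∈ D,
      ⟪w, x - z⟫ ≤ ε * ‖x - z‖ + (‖w‖ + ε) * κ * ‖P x - y‖ := by
  obtain ⟨δ₁, hδ₁, h1⟩ := hw ε hε
  obtain ⟨δ₂, hδ₂, h2⟩ := Metric.eventually_nhds_iff.1 hreg
  refine ⟨min (δ₁ / 3) (δ₂ / 2), by positivity, fun x hx y hy => ?_⟩
  have hx1 := hx.trans (min_le_left _ _)
  have hx2 := hx.trans (min_le_right _ _)
  have h3 := h2 (y := x) (by rw [dist_eq_norm]; linarith) y hy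
  obtain ⟨u, hu, hux⟩ := hΩ.exists_infDist_eq_dist ⟨z, hz⟩ x
  have h4 : Metric.infDist x {x | P x ∈ D} ≤ ‖x - z‖ := by
    rw [← dist_eq_norm]; exact Metric.infDist_le_dist_of_mem hz
  rw [hux, dist_eq_norm] at h3 h4
  have h5 : ‖u - z‖ ≤ ‖x - u‖ + ‖x - z‖ := by
    rw [norm_sub_rev x u]; exact norm_sub_le_norm_sub_add_norm_sub u x z
  have h6 := h1 u hu (by linarith)
  have h7 : ⟪w, x - z⟫ = ⟪w, x - u⟫ + ⟪w, u - z⟫ := by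
    rw [← inner_add_right]; congr 1; abel
  have h8 := real_inner_le_norm w (x - u)
  have h9 : (‖w‖ + ε) * ‖x - u‖ ≤ (‖w‖ + ε) * (κ * ‖P x - y‖) :=
    mul_le_mul_of_nonneg_left h3 (by positivity)
  nlinarith

variable [FiniteDimensional ℝ E] [FiniteDimensional ℝ F]

/-- Fuzzy multiplier rule: a regular normal to a preimage is approximated by images of regular
normals at nearby points, with a bound on the multipliers coming from the error bound. -/
theorem exists_approx_multiplier {P : E → F} {D : Set F} {z w : E}
    {κ ε : ℝ} (hP : ContDiff ℝ 1 P) (hD : IsClosed D) (hz : P z ∈ D)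
    (hw : w ∈ rnc {x | P x ∈ D} z) (hκ : 0 < κ) (hε : 0 < ε)
    (hreg : ∀ᶠ x in 𝓝 z, ∀ y ∈ D, Metric.infDist x {x | P x ∈ D} ≤ κ * ‖P x - y‖) :
    ∃ x y l m, ‖x - z‖ ≤ ε ∧ ‖y - P z‖ ≤ ε ∧ y ∈ D ∧ m ∈ rnc D y ∧ ‖l - m‖ ≤ 2 * ε ∧
      ‖l‖ ≤ 2 * ((‖w‖ + ε) * κ) ∧
      ‖w - ContinuousLinearMap.adjoint (fderiv ℝ P x) l‖ ≤ 3 * ε := by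
  have hPc := hP.continuous
  obtain ⟨δ, hδ, hpen⟩ := exists_penalty_of_mem_rnc (hD.preimage hPc) hz hw hε hreg
  set L := (‖w‖ + ε) * κ with hL
  have hL0 : 0 < L := by positivity
  obtain ⟨ρ, hρ, hρε, hρδ⟩ : ∃ ρ > 0, ρ ≤ ε ∧ ρ < δ :=
    ⟨min ε (δ / 2), by positivity, min_le_left _ _, (min_le_right _ _).trans_lt (by linarith)⟩
  obtain ⟨N, hN0, hN⟩ : ∃ N > 0, L ^ 2 = N * ρ ^ 2 :=
    ⟨L ^ 2 / ρ ^ 2, by positivity, by field_simp⟩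
  let f : E × F → ℝ := fun q => -⟪w, q.1 - z⟫ + ε * ‖q.1 - z‖ + N * ‖P q.1 - q.2‖ ^ 2 +
    ‖q.1 - z‖ ^ 2 + ‖q.2 - P z‖ ^ 2
  have hf : Continuous f := by fun_prop
  have hK : IsCompact (Metric.closedBall z δ ×ˢ (D ∩ Metric.closedBall (P z) (ρ + 1))) :=
    (isCompact_closedBall _ _).prod ((isCompact_closedBall _ _).inter_left hD)
  have hmem : (z, P z) ∈ Metric.closedBall z δ ×ˢ (D ∩ Metric.closedBall (P z) (ρ + 1)) :=
    ⟨Metric.mem_closedBall_self hδ.le, hz, Metric.mem_closedBall_self (by positivity)⟩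
  obtain ⟨⟨x, y⟩, ⟨hx, hy, hy'⟩, hmin⟩ := hK.exists_isMinOn ⟨_, hmem⟩ hf.continuousOn
  simp only [mem_closedBall_iff_norm] at hx hy hy'
  have hmin : ∀ x' y', ‖x' - z‖ ≤ δ → y' ∈ D → ‖y' - P z‖ ≤ ρ + 1 → f (x, y) ≤ f (x', y') :=
    fun x' y' h1 h2 h3 => hmin (a := (x', y'))
      ⟨mem_closedBall_iff_norm.2 h1, h2, mem_closedBall_iff_norm.2 h3⟩
  have h0 := hmin z (P z) (by simpa using hδ.le) hz (by simp; positivity)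
  have hp := hpen x hx y hy
  set r := ‖P x - y‖ with hr
  have hr0 : 0 ≤ r := norm_nonneg _
  have h1 : N * r ^ 2 + ‖x - z‖ ^ 2 + ‖y - P z‖ ^ 2 ≤ L * r := by
    simp only [f, sub_self, inner_zero_right, norm_zero] at h0
    norm_num at h0
    linarith
  have hNr : N * r ≤ L := by
    rcases hr0.eq_or_lt with h | h
    · rw [← h]; simpa using hL0.le
    · refine le_of_mul_le_mul_right ?_ h
      nlinarith [sq_nonneg ‖x - z‖, sq_nonneg ‖y - P z‖]
  have h2 : ‖x - z‖ ^ 2 + ‖y - P z‖ ^ 2 ≤ ρ ^ 2 := by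
    have : N * (L * r) ≤ N * ρ ^ 2 := by nlinarith
    have := le_of_mul_le_mul_left this hN0
    nlinarith [sq_nonneg r]
  have hxρ : ‖x - z‖ ≤ ρ := abs_le_of_sq_le_sq' (by nlinarith [sq_nonneg ‖y - P z‖]) hρ.le |>.2
  have hyρ : ‖y - P z‖ ≤ ρ := abs_le_of_sq_le_sq' (by nlinarith [sq_nonneg ‖x - z‖]) hρ.le |>.2
  refine ⟨x, y, (2 * N) • (P x - y), (2 * N) • (P x - y) - (2 : ℝ) • (y - P z),
    hxρ.trans hρε, hyρ.trans hρε, hy, ?_, ?_, ?_, ?_⟩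
  · refine mem_rnc_of_isLocalMinOn_sq_dist hN0 one_pos fun u hu huy => ?_
    have := hmin x u hx hu (by
      linarith [norm_sub_le_norm_sub_add_norm_sub u y (P z)])
    simp only [f] at this
    linarith
  · rw [sub_sub_cancel, norm_smul]
    norm_num
    linarith
  · rw [norm_smul, Real.norm_eq_abs, abs_of_pos (by positivity)]
    linarith
  · set A := fderiv ℝ P x
    have hA : HasFDerivAt P A x := (hP.differentiable one_ne_zero x).hasFDerivAt
    set v := w - ContinuousLinearMap.adjoint A ((2 * N) • (P x - y)) - (2 : ℝ) • (x - z) with hv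
    have hg : HasFDerivAt (fun u => -⟪w, u - z⟫ + N * ‖P u - y‖ ^ 2 + ‖u - z‖ ^ 2)
        (-(innerSL ℝ v)) x := by
      have d1 : HasFDerivAt (fun u : E => ⟪w, u - z⟫) (innerSL ℝ w) x := by
        exact (innerSL ℝ w).hasFDerivAt.comp x ((hasFDerivAt_id x).sub_const z)
      have d2 := (hA.sub_const y).norm_sq
      have d3 := ((hasFDerivAt_id (𝕜 := ℝ) x).sub_const z).norm_sq
      refine ((d1.neg.add (d2.const_mul N)).add d3).congr_fderiv ?_
      ext h
      simp [hv, ContinuousLinearMap.adjoint_inner_left]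
      ring
    have hev : ∀ᶠ u in 𝓝 x, (-⟪w, x - z⟫ + N * ‖P x - y‖ ^ 2 + ‖x - z‖ ^ 2) - ε * ‖u - x‖ ≤
        -⟪w, u - z⟫ + N * ‖P u - y‖ ^ 2 + ‖u - z‖ ^ 2 := by
      have hc : ContinuousAt (fun u : E => ‖u - z‖) x := by fun_prop
      filter_upwards [hc.eventually (Iio_mem_nhds (hxρ.trans_lt hρδ))] with u hu
      have h3 := hmin u y (le_of_lt hu) hy hy'
      simp only [f] at h3
      have h4 := mul_le_mul_of_nonneg_left (norm_sub_le_norm_sub_add_norm_sub u x z) hε.le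
      linarith
    have h3 := hg.neg_mul_norm_le_of_eventually hev v
    have h4 : ‖v‖ ≤ ε := by
      simp only [neg_apply, innerSL_apply_apply,
        real_inner_self_eq_norm_sq] at h3
      by_contra! hlt
      nlinarith [norm_nonneg v]
    have h5 : w - ContinuousLinearMap.adjoint A ((2 * N) • (P x - y)) = v + (2 : ℝ) • (x - z) := by
      rw [hv]; abel
    rw [h5]
    refine (norm_add_le _ _).trans ?_
    rw [norm_smul]
    norm_num
    linarith

theorem lnc_preimage_subset {P : E → F} {D : Set F} {zb : E} {κ : ℝ} (hP : ContDiff ℝ 1 P)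
    (hD : IsClosed D) (hκ : 0 < κ)
    (hreg : ∀ᶠ x in 𝓝 zb, ∀ y ∈ D, Metric.infDist x {x | P x ∈ D} ≤ κ * ‖P x - y‖) :
    lnc {x | P x ∈ D} zb ⊆
      {v | ∃ l ∈ lnc D (P zb), v = ContinuousLinearMap.adjoint (fderiv ℝ P zb) l} := by
  rintro v ⟨z, w, hzΩ, hz, hw, hrnc⟩
  obtain ⟨k₀, hk₀⟩ := eventually_atTop.1 (hz.eventually hreg.eventually_nhds)
  have hshift : Tendsto (fun k => k + k₀) atTop atTop := tendsto_add_atTop_nat k₀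
  replace hz := hz.comp hshift
  replace hw := hw.comp hshift
  have hε := tendsto_one_div_add_atTop_nhds_zero_nat (𝕜 := ℝ)
  choose x y l m hx hy hyD hm hlm hl hwl using fun k : ℕ =>
    exists_approx_multiplier hP hD (hzΩ (k + k₀)) (hrnc (k + k₀)) hκ
      (Nat.one_div_pos_of_nat (n := k) (α := ℝ)) (hk₀ (k + k₀) (Nat.le_add_left _ _))
  obtain ⟨C, hC⟩ := hw.norm.bddAbove_range
  have hlC : ∀ k, l k ∈ Metric.closedBall (0 : F) (2 * ((C + 1) * κ)) := fun k => by
    rw [mem_closedBall_zero_iff]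
    refine (hl k).trans ?_
    have h1 : ‖w (k + k₀)‖ ≤ C := hC ⟨k, rfl⟩
    have h2 : 1 / ((k : ℝ) + 1) ≤ 1 := by
      rw [div_le_one (by positivity)]; linarith [k.cast_nonneg (α := ℝ)]
    gcongr
  obtain ⟨l₀, -, φ, hφ, hlφ⟩ := (isCompact_closedBall (0 : F) _).tendsto_subseq hlC
  have hx0 : Tendsto x atTop (𝓝 zb) := by
    have := (squeeze_zero_norm hx hε).add hz
    simpa [Function.comp_def] using this
  have hy0 : Tendsto y atTop (𝓝 (P zb)) := by
    have := (squeeze_zero_norm hy hε).add ((hP.continuous.tendsto zb).comp hz)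
    simpa [Function.comp_def] using this
  have hlm0 : Tendsto (fun k => l k - m k) atTop (𝓝 0) :=
    squeeze_zero_norm hlm (by simpa using hε.const_mul 2)
  have hwl0 : Tendsto (fun k => w (k + k₀) -
      ContinuousLinearMap.adjoint (fderiv ℝ P (x k)) (l k)) atTop (𝓝 0) :=
    squeeze_zero_norm hwl (by simpa using hε.const_mul 3)
  have hφt := hφ.tendsto_atTop
  refine ⟨l₀, ⟨y ∘ φ, m ∘ φ, fun k => hyD _, hy0.comp hφt, ?_, fun k => hm _⟩, ?_⟩
  · simpa [Function.comp_def] using hlφ.sub (hlm0.comp hφt)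
  · have hA : Tendsto (fun k => ContinuousLinearMap.adjoint (fderiv ℝ P (x (φ k)))) atTop
        (𝓝 (ContinuousLinearMap.adjoint (fderiv ℝ P zb))) :=
      ((ContinuousLinearMap.adjoint.continuous.comp
        (hP.continuous_fderiv one_ne_zero)).tendsto zb).comp (hx0.comp hφt)
    have h1 := ((isBoundedBilinearMap_apply (𝕜 := ℝ)).continuous.tendsto _).comp
      (hA.prodMk_nhds hlφ)
    have h2 := (hw.comp hφt).sub (hwl0.comp hφt)
    simp only [Function.comp_def, sub_sub_cancel, sub_zero] at h1 h2
    exact tendsto_nhds_unique h2 h1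

end NormalCone

/-- under MSCQ at `zb` for `P(z) ∈ D`, one has
`N̂_Ω(zb) ⊆ N_Ω(zb) ⊆ ∇P(zb)ᵀ N_D(P(zb))` for `Ω = {z | P(z) ∈ D}`. -/
theorem stmt_8 {d s : ℕ} (P : Eu d → Eu s) (D : Set (Eu s)) (zb : Eu d)
    (hP : ContDiff ℝ 1 P) (hD : IsClosed D) (hz : P zb ∈ D)
    (hMSCQ : msr (fun z => {w | P z - w ∈ D}) zb 0) :
    rnc {z | P z ∈ D} zb ⊆ lnc {z | P z ∈ D} zb ∧
    lnc {z | P z ∈ D} zb ⊆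
      {zs | ∃ l ∈ lnc D (P zb), zs = ContinuousLinearMap.adjoint (fderiv ℝ P zb) l} := by
  obtain ⟨κ, hκ, hreg⟩ := hMSCQ.exists_infDist_le
  exact ⟨rnc_subset_lnc hz, lnc_preimage_subset hP hD hκ hreg⟩
end
end

section
/- Let φ: ℝ^n × ℝ^m → ℝ^m and G: ℝ^n × ℝ^m → ℝ^p be continuously differentiable and g: ℝ^m → ℝ^q be twice continuously differentiable, and let Ω̃ := {(x,y,λ) | h(x,y,λ) := φ(x,y) + ∇g(y)^T λ = 0, g(y) ≤ 0, λ ≥ 0, λ^T g(y) = 0, G(x,y) ≤ 0}. Let (x̄, ȳ, λ̄) ∈ Ω̃ and suppose there exists λ̂ ≠ λ̄ with (x̄, ȳ, λ̂) ∈ Ω̃. Define I_g := {i | g_i(ȳ) = 0, λ̄_i > 0}, I_λ := {i | g_i(ȳ) < 0, λ̄_i = 0}, I_0 := {i | g_i(ȳ) = 0, λ̄_i = 0}. Then for every partition (β₁, β₂) of I_0, the branch system in variables (x,y,λ) given by the equalities h(x,y,λ) = 0, g_i(y) = 0 (i ∈ I_g ∪ β₁), λ_i = 0 (i ∈ I_λ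 ∪ β₂), and the inequalities λ_i ≥ 0 (i ∈ I_g ∪ β₁), g_i(y) ≤ 0 (i ∈ I_λ ∪ β₂), G(x,y) ≤ 0, does not satisfy the Mangasarian–Fromovitz constraint qualification at (x̄, ȳ, λ̄). -/
open Filter Topology Set
open scoped RealInnerProductSpace

noncomputable section

/-- A nonnegative vector orthogonal to a nonpositive vector is complementary to it. -/
theorem apply_eq_zero_of_inner_eq_zero {q : ℕ} {l v : Eu q} (hl : ∀ i, 0 ≤ l i)
    (hv : ∀ i, v i ≤ 0) (h : ⟪l, v⟫ = 0) (i : Fin q) (hi : v i ≠ 0) : l i = 0 := by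
  rw [PiLp.inner_apply] at h
  have hzero := (Finset.sum_eq_zero_iff_of_nonpos fun j _ => by
    simpa using mul_nonpos_of_nonpos_of_nonneg (hv j) (hl j)).1 h i (Finset.mem_univ i)
  simpa [hi] using hzero

/-- A vector in the kernel of the adjoint gives a linear relation between the coordinates of the
operator. -/
theorem sum_mul_apply_eq_zero_of_adjoint_eq_zero {m q : ℕ} (A : Eu m →L[ℝ] Eu q) {w : Eu q}
    (hw : ContinuousLinearMap.adjoint A w = 0) (v : Eu m) : ∑ i, w i * A v i = 0 := by
  have h := ContinuousLinearMap.adjoint_inner_left A v w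
  rw [hw, inner_zero_left, PiLp.inner_apply] at h
  simpa [mul_comm] using h.symm

/-- The derivative of a coordinate of `g`, seen as a function of the triple `(x, y, l)`. -/
theorem fderiv_coord_apply {n m q : ℕ} {g : Eu m → Eu q} {x : Eu n} {y : Eu m} {l : Eu q}
    (hg : DifferentiableAt ℝ g y) (i : Fin q) (dz : Eu n × Eu m × Eu q) :
    fderiv ℝ (fun z : Eu n × Eu m × Eu q => g z.2.1 i) (x, y, l) dz
      = fderiv ℝ g y dz.2.1 i := by
  have hy : HasFDerivAt (fun z : Eu n × Eu m × Eu q => z.2.1)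
      ((ContinuousLinearMap.fst ℝ (Eu m) (Eu q)).comp
        (ContinuousLinearMap.snd ℝ (Eu n) (Eu m × Eu q))) (x, y, l) :=
    hasFDerivAt_snd.fst
  have hi : HasFDerivAt (fun z : Eu n × Eu m × Eu q => g z.2.1 i)
      ((EuclideanSpace.proj i).comp ((fderiv ℝ g y).comp
        ((ContinuousLinearMap.fst ℝ (Eu m) (Eu q)).comp
          (ContinuousLinearMap.snd ℝ (Eu n) (Eu m × Eu q))))) (x, y, l) :=
    (EuclideanSpace.proj (𝕜 := ℝ) i).hasFDerivAt.comp (x, y, l)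
      (HasFDerivAt.comp (x, y, l) (f := fun z : Eu n × Eu m × Eu q => z.2.1) hg.hasFDerivAt hy)
  rw [hi.fderiv]
  rfl

/-- if the lower-level multiplier is not unique, then for every partition
`(β₁, β₂)` of the biactive index set `I₀`, the corresponding branch of the MPCC constraint
system fails the Mangasarian–Fromovitz constraint qualification at `(x̄, ȳ, λ̄)`.

The branch system (in the variable `z = (x, y, λ) ∈ ℝⁿ × ℝᵐ × ℝ^q`) consists of the
equalities `h(x,y,λ) = φ(x,y) + ∇g(y)ᵀλ = 0`, `g_i(y) = 0 (i ∈ I_g ∪ β₁)`,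
`λ_i = 0 (i ∈ I_λ ∪ β₂)` and the inequalities `-λ_i ≤ 0 (i ∈ I_g ∪ β₁)`,
`g_i(y) ≤ 0 (i ∈ I_λ ∪ β₂)`, `G(x,y) ≤ 0`.  MFCQ means: the gradients of the equality
constraints are linearly independent and there is a direction `dz` annihilating all
equality-constraint gradients on which the gradients of all *active* inequality
constraints are negative. -/
theorem stmt_11 {n m p q : ℕ}
    (φ : Eu n × Eu m → Eu m) (G : Eu n × Eu m → Eu p) (g : Eu m → Eu q)
    (hφ : ContDiff ℝ 1 φ) (hG : ContDiff ℝ 1 G) (hg : ContDiff ℝ 2 g)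
    (xb : Eu n) (yb : Eu m) (lb lh : Eu q)
    -- feasibility of (xb, yb, lb) for the MPCC constraint system
    (hfeas : φ (xb, yb) + ContinuousLinearMap.adjoint (fderiv ℝ g yb) lb = 0 ∧
      (∀ i, g yb i ≤ 0) ∧ (∀ i, 0 ≤ lb i) ∧ ⟪lb, g yb⟫ = 0 ∧ ∀ j, G (xb, yb) j ≤ 0)
    -- a second multiplier lh ≠ lb is feasible as well
    (hfeas' : φ (xb, yb) + ContinuousLinearMap.adjoint (fderiv ℝ g yb) lh = 0 ∧
      (∀ i, 0 ≤ lh i) ∧ ⟪lh, g yb⟫ = 0)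
    (hne : lh ≠ lb)
    -- (β₁, β₂) is a partition of the biactive set I₀
    (β₁ β₂ : Set (Fin q))
    (hUnion : β₁ ∪ β₂ = {i | g yb i = 0 ∧ lb i = 0}) (hDisj : β₁ ∩ β₂ = ∅) :
    ¬ ((LinearIndependent ℝ
          (fun j : (Fin m ⊕ (↥({i | g yb i = 0 ∧ 0 < lb i} ∪ β₁) ⊕
              ↥({i | g yb i < 0 ∧ lb i = 0} ∪ β₂))) =>
            fderiv ℝ
              (Sum.elim
                (fun i : Fin m => fun z : Eu n × Eu m × Eu q =>
                  (φ (z.1, z.2.1) +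
                    ContinuousLinearMap.adjoint (fderiv ℝ g z.2.1) z.2.2) i)
                (Sum.elim
                  (fun i : ↥({i | g yb i = 0 ∧ 0 < lb i} ∪ β₁) =>
                    fun z : Eu n × Eu m × Eu q => g z.2.1 i.1)
                  (fun i : ↥({i | g yb i < 0 ∧ lb i = 0} ∪ β₂) =>
                    fun z : Eu n × Eu m × Eu q => z.2.2 i.1)) j)
              (xb, yb, lb))) ∧
      ∃ dz : Eu n × Eu m × Eu q,
        -- dz annihilates the gradients of all equality constraints
        (∀ i : Fin m,
          fderiv ℝ (fun z : Eu n × Eu m × Eu q =>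
            (φ (z.1, z.2.1) +
              ContinuousLinearMap.adjoint (fderiv ℝ g z.2.1) z.2.2) i) (xb, yb, lb) dz = 0) ∧
        (∀ i ∈ {i | g yb i = 0 ∧ 0 < lb i} ∪ β₁,
          fderiv ℝ (fun z : Eu n × Eu m × Eu q => g z.2.1 i) (xb, yb, lb) dz = 0) ∧
        (∀ i ∈ {i | g yb i < 0 ∧ lb i = 0} ∪ β₂,
          fderiv ℝ (fun z : Eu n × Eu m × Eu q => z.2.2 i) (xb, yb, lb) dz = 0) ∧
        -- strict descent of the gradients of the active inequality constraints
        (∀ i ∈ {i | g yb i = 0 ∧ 0 < lb i} ∪ β₁, lb i = 0 →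
          fderiv ℝ (fun z : Eu n × Eu m × Eu q => -z.2.2 i) (xb, yb, lb) dz < 0) ∧
        (∀ i ∈ {i | g yb i < 0 ∧ lb i = 0} ∪ β₂, g yb i = 0 →
          fderiv ℝ (fun z : Eu n × Eu m × Eu q => g z.2.1 i) (xb, yb, lb) dz < 0) ∧
        (∀ j : Fin p, G (xb, yb) j = 0 →
          fderiv ℝ (fun z : Eu n × Eu m × Eu q => G (z.1, z.2.1) j) (xb, yb, lb) dz < 0)) := by
  rintro ⟨hLI, dz, -, hd_eq, -, -, hd_lt, -⟩
  obtain ⟨hstat, hgle, hlb, hcomp, -⟩ := hfeas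
  obtain ⟨hstat', hlh, hcomp'⟩ := hfeas'
  have hgd : DifferentiableAt ℝ g yb := hg.differentiable (by norm_num) yb
  have hadj : ContinuousLinearMap.adjoint (fderiv ℝ g yb) (lh - lb) = 0 := by
    rw [map_sub, sub_eq_zero]
    exact add_left_cancel (hstat'.trans hstat.symm)
  have hrel : ∀ v : Eu n × Eu m × Eu q, ∑ i, (lh i - lb i) *
      fderiv ℝ (fun z : Eu n × Eu m × Eu q => g z.2.1 i) (xb, yb, lb) v = 0 := by
    intro v
    simpa only [fderiv_coord_apply hgd, PiLp.sub_apply] using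
      sum_mul_apply_eq_zero_of_adjoint_eq_zero (fderiv ℝ g yb) hadj v.2.1
  have hβ₂ : ∀ i ∈ β₂, g yb i = 0 ∧ lb i = 0 := fun i hi =>
    hUnion.subset (Or.inr hi)
  have hsupp : ∀ i, i ∉ {i | g yb i = 0 ∧ 0 < lb i} ∪ β₁ → i ∉ β₂ → lh i - lb i = 0 := by
    intro i hi hi₂
    have hgi : g yb i ≠ 0 := by
      intro hgi
      rcases (hlb i).eq_or_lt with h | h
      · rcases hUnion.superset (show i ∈ {i | g yb i = 0 ∧ lb i = 0} from ⟨hgi, h.symm⟩)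
          with h₁ | h₂
        · exact hi (Or.inr h₁)
        · exact hi₂ h₂
      · exact hi (Or.inl ⟨hgi, h⟩)
    rw [apply_eq_zero_of_inner_eq_zero hlb hgle hcomp i hgi,
      apply_eq_zero_of_inner_eq_zero hlh hgle hcomp' i hgi, sub_zero]
  have hterm_le : ∀ i ∈ Finset.univ, (lh i - lb i) *
      fderiv ℝ (fun z : Eu n × Eu m × Eu q => g z.2.1 i) (xb, yb, lb) dz ≤ 0 := by
    intro i _
    by_cases hi : i ∈ {i | g yb i = 0 ∧ 0 < lb i} ∪ β₁
    · rw [hd_eq i hi, mul_zero]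
    by_cases hi₂ : i ∈ β₂
    · refine mul_nonpos_of_nonneg_of_nonpos ?_ (hd_lt i (Or.inr hi₂) (hβ₂ i hi₂).1).le
      rw [(hβ₂ i hi₂).2, sub_zero]
      exact hlh i
    · rw [hsupp i hi hi₂, zero_mul]
  have hzero₂ : ∀ i ∈ β₂, lh i - lb i = 0 := by
    intro i hi
    have h := (Finset.sum_eq_zero_iff_of_nonpos hterm_le).1 (hrel dz) i (Finset.mem_univ i)
    exact (mul_eq_zero.1 h).resolve_right (hd_lt i (Or.inr hi) (hβ₂ i hi).1).ne
  have hLIg : LinearIndepOn ℝ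
      (fun i => fderiv ℝ (fun z : Eu n × Eu m × Eu q => g z.2.1 i) (xb, yb, lb))
      ({i | g yb i = 0 ∧ 0 < lb i} ∪ β₁) :=
    hLI.comp (Sum.inr ∘ Sum.inl) (Sum.inr_injective.comp Sum.inl_injective)
  have hsub : ((Finset.univ.filter fun i => lh i - lb i ≠ 0 : Finset (Fin q)) : Set (Fin q)) ⊆
      {i | g yb i = 0 ∧ 0 < lb i} ∪ β₁ := by
    intro i hi
    by_contra hiS
    exact (Finset.mem_filter.1 hi).2 (hsupp i hiS fun hi₂ =>
      (Finset.mem_filter.1 hi).2 (hzero₂ i hi₂))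
  have hsum : ∑ i ∈ Finset.univ.filter (fun i => lh i - lb i ≠ 0), (lh i - lb i) •
      fderiv ℝ (fun z : Eu n × Eu m × Eu q => g z.2.1 i) (xb, yb, lb) = 0 := by
    rw [Finset.sum_filter_of_ne fun i _ h => left_ne_zero_of_smul h]
    refine ContinuousLinearMap.ext fun v => ?_
    simpa only [sum_apply, smul_apply, smul_eq_mul,
      zero_apply] using hrel v
  refine hne (PiLp.ext fun i => sub_eq_zero.1 ?_)
  by_contra hi
  exact hi (linearIndepOn_iff'.1 hLIg _ _ hsub hsum i
    (Finset.mem_filter.2 ⟨Finset.mem_univ i, hi⟩))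
end
end

section
/- Let φ: ℝ^n × ℝ^m → ℝ^m and G: ℝ^n × ℝ^m → ℝ^p be continuously differentiable and g: ℝ^m → ℝ^q be twice continuously differentiable, and let Ω̃ := {(x,y,λ) | h(x,y,λ) := φ(x,y) + ∇g(y)^T λ = 0, g(y) ≤ 0, λ ≥ 0, λ^T g(y) = 0, G(x,y) ≤ 0}. Let (x̄, ȳ, λ̄) ∈ Ω̃ and suppose there exists λ̂ ≠ λ̄ with (x̄, ȳ, λ̂) ∈ Ω̃. Then MPCC-LICQ fails at (x̄, ȳ, λ̄): the family of vectors ∇h_i(x̄,ȳ,λ̄) (i = 1,…,m), (0, ∇g_i(ȳ), 0) for i ∈ I_g ∪ I_0, (0, 0, e_i) for i ∈ I_λ ∪ I_0, and (∇G_i(x̄,ȳ), 0) for i ∈ I_G is linearly dependent. -/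
open Filter Topology Set
open scoped RealInnerProductSpace

noncomputable section

/-- Complementary slackness, componentwise: if `lam ≥ 0`, `c ≤ 0` and `⟪lam, c⟫ = 0`, then
`lam` vanishes wherever `c < 0`. -/
theorem eq_zero_of_inner_eq_zero_of_neg {q : ℕ} {lam c : Eu q} (hlam : ∀ i, 0 ≤ lam i)
    (hc : ∀ i, c i ≤ 0) (h : ⟪lam, c⟫ = 0) {i : Fin q} (hi : c i < 0) : lam i = 0 := by
  rw [PiLp.inner_apply, Finset.sum_eq_zero_iff_of_nonpos] at h
  · have h' := h i (Finset.mem_univ i)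
    simp only [RCLike.inner_apply, conj_trivial, mul_eq_zero] at h'
    exact h'.resolve_left hi.ne
  · intro j _
    simpa using mul_nonpos_of_nonpos_of_nonneg (hc j) (hlam j)

/-- The differential of the `i`-th component of `g`, seen as a function of `(x, y, z)`. -/
theorem fderiv_component_apply {q : ℕ} {X Y Z : Type*} [NormedAddCommGroup X] [NormedSpace ℝ X]
    [NormedAddCommGroup Y] [NormedSpace ℝ Y] [NormedAddCommGroup Z] [NormedSpace ℝ Z]
    {g : Y → Eu q} {z : X × Y × Z} (hg : DifferentiableAt ℝ g z.2.1) (i : Fin q)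
    (v : X × Y × Z) :
    fderiv ℝ (fun w : X × Y × Z => g w.2.1 i) z v = fderiv ℝ g z.2.1 v.2.1 i := by
  have hy : HasFDerivAt (fun w : X × Y × Z => w.2.1)
      ((ContinuousLinearMap.fst ℝ Y Z).comp (ContinuousLinearMap.snd ℝ X (Y × Z))) z :=
    hasFDerivAt_snd.fst
  have h := (EuclideanSpace.proj (𝕜 := ℝ) i).hasFDerivAt.comp z
    (hg.hasFDerivAt.comp z hy)
  have h' : HasFDerivAt (fun w : X × Y × Z => g w.2.1 i) _ z := h
  rw [h'.fderiv]
  rfl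

/-- if the lower-level multiplier is not unique, then MPCC-LICQ fails at
`(x̄, ȳ, λ̄)`: the family consisting of the gradients (as linear functionals on
`ℝⁿ × ℝᵐ × ℝ^q`) of `h_i` (`i = 1, …, m`), of `z ↦ g_i(y)` for `i ∈ I_g ∪ I₀`, of
`z ↦ λ_i` for `i ∈ I_λ ∪ I₀`, and of `z ↦ G_i(x, y)` for `i ∈ I_G`, is linearly
dependent. -/
theorem stmt_12 {n m p q : ℕ}
    (φ : Eu n × Eu m → Eu m) (G : Eu n × Eu m → Eu p) (g : Eu m → Eu q)
    (hφ : ContDiff ℝ 1 φ) (hG : ContDiff ℝ 1 G) (hg : ContDiff ℝ 2 g)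
    (xb : Eu n) (yb : Eu m) (lb lh : Eu q)
    -- feasibility of (xb, yb, lb) for the MPCC constraint system
    (hfeas : φ (xb, yb) + ContinuousLinearMap.adjoint (fderiv ℝ g yb) lb = 0 ∧
      (∀ i, g yb i ≤ 0) ∧ (∀ i, 0 ≤ lb i) ∧ ⟪lb, g yb⟫ = 0 ∧ ∀ j, G (xb, yb) j ≤ 0)
    -- a second multiplier lh ≠ lb is feasible as well
    (hfeas' : φ (xb, yb) + ContinuousLinearMap.adjoint (fderiv ℝ g yb) lh = 0 ∧
      (∀ i, 0 ≤ lh i) ∧ ⟪lh, g yb⟫ = 0)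
    (hne : lh ≠ lb) :
    ¬ LinearIndependent ℝ
        (Sum.elim
          (fun i : Fin m =>
            fderiv ℝ (fun z : Eu n × Eu m × Eu q =>
              (φ (z.1, z.2.1) +
                ContinuousLinearMap.adjoint (fderiv ℝ g z.2.1) z.2.2) i) (xb, yb, lb))
          (Sum.elim
            (fun i : ↥({i | g yb i = 0 ∧ 0 < lb i} ∪ {i | g yb i = 0 ∧ lb i = 0}) =>
              fderiv ℝ (fun z : Eu n × Eu m × Eu q => g z.2.1 i.1) (xb, yb, lb))
            (Sum.elim
              (fun i : ↥({i | g yb i < 0 ∧ lb i = 0} ∪ {i | g yb i = 0 ∧ lb i = 0}) =>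
                fderiv ℝ (fun z : Eu n × Eu m × Eu q => z.2.2 i.1) (xb, yb, lb))
              (fun j : ↥{j | G (xb, yb) j = 0} =>
                fderiv ℝ (fun z : Eu n × Eu m × Eu q => G (z.1, z.2.1) j.1) (xb, yb, lb))))) := by
  classical
  obtain ⟨hb, hg0, hlb, hslack, -⟩ := hfeas
  obtain ⟨hh, hlh, hslack'⟩ := hfeas'
  intro hLI
  replace hLI := (hLI.comp _ Sum.inr_injective).comp _ Sum.inl_injective
  have hadj : ContinuousLinearMap.adjoint (fderiv ℝ g yb) (lh - lb) = 0 := by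
    rw [map_sub, sub_eq_zero]
    exact add_left_cancel (hh.trans hb.symm)
  have hinactive : ∀ i, g yb i < 0 → (lh - lb) i = 0 := fun i hi => by
    simp [eq_zero_of_inner_eq_zero_of_neg hlh hg0 hslack' hi,
      eq_zero_of_inner_eq_zero_of_neg hlb hg0 hslack hi]
  have hactive : ∀ i, g yb i = 0 →
      i ∈ {i | g yb i = 0 ∧ 0 < lb i} ∪ {i | g yb i = 0 ∧ lb i = 0} := fun i hi =>
    (hlb i).lt_or_eq.imp (fun h => ⟨hi, h⟩) (fun h => ⟨hi, h.symm⟩)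
  have hzero := Fintype.linearIndependent_iff.mp hLI (fun i => (lh - lb) i.1) (by
    refine ContinuousLinearMap.ext fun v => ?_
    simp only [Function.comp_apply, Sum.elim_inr, Sum.elim_inl,
      sum_apply, smul_apply, smul_eq_mul,
      zero_apply]
    have hsum : ∑ i, (lh - lb) i * fderiv ℝ g yb v.2.1 i = 0 := by
      have h := ContinuousLinearMap.adjoint_inner_left (fderiv ℝ g yb) v.2.1 (lh - lb)
      rw [hadj, inner_zero_left, PiLp.inner_apply] at h
      simpa [mul_comm] using h.symm
    have hd : DifferentiableAt ℝ g yb := hg.differentiable two_ne_zero yb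
    rw [← hsum, Finset.sum_congr rfl fun i _ => congrArg ((lh - lb) i.1 * ·)
      (fderiv_component_apply (z := (xb, yb, lb)) hd i.1 v)]
    refine Fintype.sum_of_injective Subtype.val Subtype.val_injective _ _
      (fun i hi => ?_) fun _ => rfl
    rw [hinactive i ((hg0 i).lt_of_ne fun h => hi ⟨⟨i, hactive i h⟩, rfl⟩), zero_mul])
  refine hne (sub_eq_zero.mp ?_)
  ext i
  rcases (hg0 i).lt_or_eq with hi | hi
  · exact hinactive i hi
  · exact hzero ⟨i, hactive i hi⟩
end
end
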